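/- Let s, ℓ, c₇ > 0 be real numbers and let θ₁, θ₂ ∈ ℝ satisfy tan θ₁ = √(ℓ/s) and tan θ₂ = −√(s/ℓ). In terms of the dual basis v¹,…,v⁷ of the standard basis of ℝ⁷, define the alternating forms ω = √(sℓ)(v¹∧v⁴ + v²∧v⁵ − v³∧v⁶), Ω₊ = s^{3/2} v¹∧v²∧v³ + ℓ√s (v¹∧v⁵∧v⁶ − v²∧v⁴∧v⁶ − v³∧v⁴∧v⁵), Ω₋ = ℓ^{3/2} v⁴∧v⁵∧v⁶ + s√ℓ (v²∧v³∧v⁴ − v¹∧v³∧v⁵ − v¹∧v²∧v⁶), and for θ ∈ ℝ set Ω₊^θ = cos θ · Ω₊ − sin θ · Ω₋ and φ^θ = √c₇ v⁷∧ω + Ω₊^θ. Let φ³ = φ^0, φ⁴ = φ^{θ₁}, φ⁵ = φ^{θ₂}. Then there exist ε₄, ε₅ ∈ {+1, −1} such that for all x, y ∈ ℝ⁷, (i_x φ⁴) ∧ (i_y φ⁴) ∧ φ⁴ = ε₄ · (i_x φ³) ∧ (i_y φ³) ∧ φ³ and (i_x φ⁵) ∧ (i_y φ⁵) ∧ φ⁵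 = ε₅ · (i_x φ³) ∧ (i_y φ³) ∧ φ³. In particular φ³, φ⁴ and φ⁵ determine the same metric on ℝ⁷ via the formula g(X,Y) dvol = (1/6)(i_X φ)∧(i_Y φ)∧φ. -/

import Mathlib

/-- The basic 1-form `vᶦ` (the `i`-th dual basis vector of `ℝ⁷`), as an element of the exterior
algebra of forms on `ℝ⁷`; wedge product of forms is multiplication in this algebra. -/
noncomputable def v7 (i : Fin 7) : ExteriorAlgebra ℝ (Fin 7 → ℝ) :=
  ExteriorAlgebra.ι ℝ (Pi.single i 1)

/-- The interior product (contraction) `i_x` of forms on `ℝ⁷` with the vector `x ∈ ℝ⁷`. -/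
noncomputable def interiorProd (x : Fin 7 → ℝ) :
    ExteriorAlgebra ℝ (Fin 7 → ℝ) →ₗ[ℝ] ExteriorAlgebra ℝ (Fin 7 → ℝ) :=
  CliffordAlgebra.contractLeft
    (∑ i, x i • (LinearMap.proj i : (Fin 7 → ℝ) →ₗ[ℝ] ℝ))

namespace ExteriorAlgebra

variable {R M : Type*} [CommRing R] [AddCommGroup M] [Module R M]

open CliffordAlgebra (contractLeft contractLeft_ι_mul)

theorem ι_mul_ι_swap (a b : M) : ι R a * ι R b = -(ι R b * ι R a) :=
  eq_neg_of_add_eq_zero_left (ι_add_mul_swap a b)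

theorem ι_mul_ι_swap_assoc (a b : M) (w : ExteriorAlgebra R M) :
    ι R a * (ι R b * w) = -(ι R b * (ι R a * w)) := by
  rw [← mul_assoc, ι_mul_ι_swap, neg_mul, mul_assoc]

theorem ι_mul_ι_self_assoc (a : M) (w : ExteriorAlgebra R M) :
    ι R a * (ι R a * w) = 0 := by
  rw [← mul_assoc, ι_sq_zero, zero_mul]

theorem ι_mul_ι_mul_ι_self (a b : M) : ι R a * ι R b * ι R a = 0 := by
  rw [ι_mul_ι_swap, neg_mul, mul_assoc, ι_sq_zero, mul_zero, neg_zero]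

/-- Two-forms are central. -/
theorem commute_of_mem_range_ι_sq {u : ExteriorAlgebra R M}
    (hu : u ∈ LinearMap.range (ι R (M := M)) ^ 2) (w : ExteriorAlgebra R M) : Commute u w := by
  rw [sq] at hu
  induction hu using Submodule.mul_induction_on' with
  | mem_mul_mem a ha b hb =>
    obtain ⟨a, rfl⟩ := ha
    obtain ⟨b, rfl⟩ := hb
    induction w using ExteriorAlgebra.induction with
    | algebraMap r => exact (Algebra.commutes r _).symm
    | ι m =>
      rw [commute_iff_eq, mul_assoc, ι_mul_ι_swap b m, mul_neg, ← mul_assoc, ι_mul_ι_swap a m,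
        neg_mul, neg_neg, mul_assoc]
    | mul x y hx hy => exact hx.mul_right hy
    | add x y hx hy => exact hx.add_right hy
  | add x _ y _ hx hy => exact hx.add_left hy

/-- Contraction with a two-form as first factor satisfies the Leibniz rule. -/
theorem contractLeft_mul_of_mem_range_ι_sq (d : Module.Dual R M) {u : ExteriorAlgebra R M}
    (hu : u ∈ LinearMap.range (ι R (M := M)) ^ 2) (w : ExteriorAlgebra R M) :
    contractLeft d (u * w) = contractLeft d u * w + u * contractLeft d w := by
  rw [sq] at hu
  induction hu using Submodule.mul_induction_on' with
  | mem_mul_mem a ha b hb =>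
    obtain ⟨a, rfl⟩ := ha
    obtain ⟨b, rfl⟩ := hb
    simp only [mul_assoc, contractLeft_ι_mul, CliffordAlgebra.contractLeft_ι, mul_sub, sub_mul,
      smul_mul_assoc, mul_smul_comm, Algebra.algebraMap_eq_smul_one, mul_one]
    abel
  | add x _ y _ hx hy =>
    rw [add_mul, map_add, map_add, hx, hy]
    noncomm_ring

theorem contractLeft_mem_pow (N : Submodule R M) (d : Module.Dual R M) (n : ℕ)
    {w : ExteriorAlgebra R M} (hw : w ∈ (N.map (ι R)) ^ (n + 1)) :
    contractLeft d w ∈ (N.map (ι R)) ^ n := by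
  induction n generalizing w with
  | zero =>
    rw [zero_add, pow_one] at hw
    obtain ⟨m, -, rfl⟩ := hw
    rw [CliffordAlgebra.contractLeft_ι, pow_zero]
    exact Submodule.algebraMap_mem _
  | succ n ih =>
    rw [pow_succ'] at hw
    induction hw using Submodule.mul_induction_on' with
    | mem_mul_mem a ha b hb =>
      obtain ⟨m, hm, rfl⟩ := ha
      rw [contractLeft_ι_mul]
      refine sub_mem (Submodule.smul_mem _ _ hb) ?_
      rw [pow_succ']
      exact Submodule.mul_mem_mul (Submodule.mem_map_of_mem hm) (ih hb)
    | add x _ y _ hx hy =>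
      rw [map_add]
      exact add_mem hx hy

/-- Products of more than `n` elements of the span of `n` one-forms vanish. -/
theorem span_range_pow_eq_bot {n k : ℕ} (g : Fin n → M) (hk : n < k) :
    ((Submodule.span R (Set.range g)).map (ι R)) ^ k = ⊥ := by
  rw [Submodule.map_span, Submodule.span_pow, Submodule.span_eq_bot]
  intro x hx
  obtain ⟨f, rfl⟩ := Set.mem_pow.1 hx
  have hf : ∀ i, ∃ j, ι R (g j) = f i := fun i => by
    obtain ⟨_, ⟨j, rfl⟩, h⟩ := (f i).2
    exact ⟨j, h⟩
  choose j hj using hf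
  obtain ⟨i, i', hne, hi⟩ := Fintype.exists_ne_map_eq_of_card_lt j (by simpa using hk)
  simp only [← hj]
  rw [← ιMulti_apply (R := R) (fun i => g (j i))]
  exact AlternatingMap.map_eq_zero_of_eq _ _ (by rw [hi]) hne

/-- The two-form `a₀ ∧ b₀ + a₁ ∧ b₁ - a₂ ∧ b₂`. -/
def kahlerForm (a b : Fin 3 → M) : ExteriorAlgebra R M :=
  ι R (a 0) * ι R (b 0) + ι R (a 1) * ι R (b 1) - ι R (a 2) * ι R (b 2)

/-- The real part of `(a₀ + i b₀) ∧ (a₁ + i b₁) ∧ (a₂ - i b₂)`. -/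
def volRe (a b : Fin 3 → M) : ExteriorAlgebra R M :=
  ι R (a 0) * ι R (a 1) * ι R (a 2) + (ι R (a 0) * ι R (b 1) * ι R (b 2)
    - ι R (a 1) * ι R (b 0) * ι R (b 2) - ι R (a 2) * ι R (b 0) * ι R (b 1))

/-- The imaginary part of `(a₀ + i b₀) ∧ (a₁ + i b₁) ∧ (a₂ - i b₂)`. -/
def volIm (a b : Fin 3 → M) : ExteriorAlgebra R M :=
  ι R (b 0) * ι R (b 1) * ι R (b 2) + (ι R (a 1) * ι R (a 2) * ι R (b 0)
    - ι R (a 0) * ι R (a 2) * ι R (b 1) - ι R (a 0) * ι R (a 1) * ι R (b 2))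

section PhaseInvariance

variable (a b : Fin 3 → M) (d d' : Module.Dual R M)

local notation "ω" => kahlerForm (R := R) a b
local notation "Ωp" => volRe (R := R) a b
local notation "Ωm" => volIm (R := R) a b

theorem kahlerForm_mem : ω ∈ LinearMap.range (ι R (M := M)) ^ 2 := by
  have h (x y : M) : ι R x * ι R y ∈ LinearMap.range (ι R (M := M)) ^ 2 := by
    rw [sq]
    exact Submodule.mul_mem_mul ⟨x, rfl⟩ ⟨y, rfl⟩
  exact sub_mem (add_mem (h _ _) (h _ _)) (h _ _)

theorem mul_mul_mem_cube {N : Submodule R M} {x y z : M} (hx : x ∈ N) (hy : y ∈ N) (hz : z ∈ N) :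
    ι R x * ι R y * ι R z ∈ (N.map (ι R)) ^ 3 := by
  rw [pow_succ, sq]
  exact Submodule.mul_mem_mul (Submodule.mul_mem_mul (Submodule.mem_map_of_mem hx)
    (Submodule.mem_map_of_mem hy)) (Submodule.mem_map_of_mem hz)

theorem volRe_mem {N : Submodule R M} (ha : ∀ i, a i ∈ N) (hb : ∀ i, b i ∈ N) :
    Ωp ∈ (N.map (ι R)) ^ 3 := by
  unfold volRe
  exact add_mem (mul_mul_mem_cube (ha _) (ha _) (ha _))
    (sub_mem (sub_mem (mul_mul_mem_cube (ha _) (hb _) (hb _))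
      (mul_mul_mem_cube (ha _) (hb _) (hb _))) (mul_mul_mem_cube (ha _) (hb _) (hb _)))

theorem volIm_mem {N : Submodule R M} (ha : ∀ i, a i ∈ N) (hb : ∀ i, b i ∈ N) :
    Ωm ∈ (N.map (ι R)) ^ 3 := by
  unfold volIm
  exact add_mem (mul_mul_mem_cube (hb _) (hb _) (hb _))
    (sub_mem (sub_mem (mul_mul_mem_cube (ha _) (ha _) (hb _))
      (mul_mul_mem_cube (ha _) (ha _) (hb _))) (mul_mul_mem_cube (ha _) (ha _) (hb _)))

theorem kahlerForm_mul_volRe : ω * Ωp = 0 := by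
  simp only [kahlerForm, volRe, mul_add, mul_sub, add_mul, sub_mul, mul_assoc]
  simp only [ι_mul_ι_swap (b 2) (b 1), ι_mul_ι_swap (b _) (a _),
    ι_mul_ι_swap_assoc (a 1) (a 0), ι_mul_ι_swap_assoc (a 2) (a 0),
    ι_mul_ι_swap_assoc (a 2) (a 1), ι_mul_ι_swap_assoc (b 1) (b 0),
    ι_mul_ι_swap_assoc (b 2) (b 0), ι_mul_ι_swap_assoc (b 2) (b 1),
    ι_mul_ι_swap_assoc (b _) (a _), ι_mul_ι_self_assoc, ι_sq_zero, mul_neg, neg_neg, mul_zero,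
    neg_zero]
  abel

theorem kahlerForm_mul_volIm : ω * Ωm = 0 := by
  simp only [kahlerForm, volIm, mul_add, mul_sub, add_mul, sub_mul, mul_assoc]
  simp only [ι_mul_ι_swap (b 1) (b 0), ι_mul_ι_swap (b 2) (b 0), ι_mul_ι_swap (b 2) (b 1),
    ι_mul_ι_swap_assoc (a 1) (a 0), ι_mul_ι_swap_assoc (a 2) (a 0),
    ι_mul_ι_swap_assoc (a 2) (a 1), ι_mul_ι_swap_assoc (b 1) (b 0),
    ι_mul_ι_swap_assoc (b 2) (b 0), ι_mul_ι_swap_assoc (b 2) (b 1),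
    ι_mul_ι_swap_assoc (b _) (a _), ι_mul_ι_self_assoc, ι_sq_zero, mul_neg, neg_neg, mul_zero,
    neg_zero]
  abel

theorem contractLeft_volRe_mul_volRe :
    contractLeft d Ωp * Ωp = contractLeft d Ωm * Ωm := by
  simp only [volRe, volIm, map_add, map_sub, mul_assoc, contractLeft_ι_mul,
    CliffordAlgebra.contractLeft_ι, Algebra.algebraMap_eq_smul_one, mul_add, mul_sub, add_mul,
    sub_mul, smul_mul_assoc, mul_smul_comm, mul_one]
  simp only [ι_mul_ι_swap (b 1) (b 0), ι_mul_ι_swap (b 2) (b 0), ι_mul_ι_swap (b 2) (b 1),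
    ι_mul_ι_swap (b _) (a _),
    ι_mul_ι_swap_assoc (a 1) (a 0), ι_mul_ι_swap_assoc (a 2) (a 0),
    ι_mul_ι_swap_assoc (a 2) (a 1), ι_mul_ι_swap_assoc (b 1) (b 0),
    ι_mul_ι_swap_assoc (b 2) (b 0), ι_mul_ι_swap_assoc (b 2) (b 1),
    ι_mul_ι_swap_assoc (b _) (a _), ι_mul_ι_self_assoc, ι_sq_zero, mul_neg, neg_neg, mul_zero,
    neg_zero, smul_zero]
  module

theorem contractLeft_volRe_mul_volIm :
    contractLeft d Ωp * Ωm = -(contractLeft d Ωm * Ωp) := by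
  simp only [volRe, volIm, map_add, map_sub, mul_assoc, contractLeft_ι_mul,
    CliffordAlgebra.contractLeft_ι, Algebra.algebraMap_eq_smul_one, mul_add, mul_sub, add_mul,
    sub_mul, smul_mul_assoc, mul_smul_comm, mul_one]
  simp only [ι_mul_ι_swap (b 1) (b 0), ι_mul_ι_swap (b 2) (b 0), ι_mul_ι_swap (b 2) (b 1),
    ι_mul_ι_swap (b _) (a _),
    ι_mul_ι_swap_assoc (a 1) (a 0), ι_mul_ι_swap_assoc (a 2) (a 0),
    ι_mul_ι_swap_assoc (a 2) (a 1), ι_mul_ι_swap_assoc (b 1) (b 0),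
    ι_mul_ι_swap_assoc (b 2) (b 0), ι_mul_ι_swap_assoc (b 2) (b 1),
    ι_mul_ι_swap_assoc (b _) (a _), ι_mul_ι_self_assoc, ι_sq_zero, mul_neg, neg_neg, mul_zero,
    neg_zero, smul_zero]
  module

theorem contractLeft_mul_contractLeft_mul_kahlerForm {P Q P' Q' : ExteriorAlgebra R M}
    (hP : contractLeft d P ∈ LinearMap.range (ι R (M := M)) ^ 2)
    (hP' : contractLeft d P' ∈ LinearMap.range (ι R (M := M)) ^ 2)
    (h : contractLeft d P * Q = contractLeft d P' * Q') (hω : ω * Q = 0) (hω' : ω * Q' = 0) :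
    contractLeft d P * contractLeft d' Q * ω = contractLeft d P' * contractLeft d' Q' * ω := by
  have key := congrArg (fun w => contractLeft d' w * ω) h
  simp only [contractLeft_mul_of_mem_range_ι_sq _ hP, contractLeft_mul_of_mem_range_ι_sq _ hP',
    add_mul, mul_assoc] at key
  rw [← (commute_of_mem_range_ι_sq (kahlerForm_mem a b) Q).eq,
    ← (commute_of_mem_range_ι_sq (kahlerForm_mem a b) Q').eq, hω, hω', mul_zero, mul_zero,
    zero_add, zero_add] at key
  simpa only [mul_assoc] using key

variable {a b}

theorem contractLeft_mul_contractLeft_mul_add (e : M) {Q : ExteriorAlgebra R M}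
    (hd : contractLeft d Q ∈ LinearMap.range (ι R (M := M)) ^ 2)
    (hd' : contractLeft d' Q ∈ LinearMap.range (ι R (M := M)) ^ 2)
    (hω : ω * Q = 0) (hQ : contractLeft d Q * contractLeft d' Q * Q = 0) :
    contractLeft d (ι R e * ω + Q) * contractLeft d' (ι R e * ω + Q) * (ι R e * ω + Q)
      = contractLeft d (ι R e * ω) * contractLeft d' (ι R e * ω) * (ι R e * ω)
        + contractLeft d (ι R e * ω) * (contractLeft d' Q * Q)
        + contractLeft d' (ι R e * ω) * (contractLeft d Q * Q)
        + ι R e * (contractLeft d Q * contractLeft d' Q * ω) := by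
  have hωmem := kahlerForm_mem (R := R) a b
  have hωc := commute_of_mem_range_ι_sq hωmem
  have hαmem (f : Module.Dual R M) : ∃ m, ι R m = contractLeft f ω := by
    have h2 : ω ∈ ((⊤ : Submodule R M).map (ι R)) ^ (1 + 1) := by
      rwa [← LinearMap.range_eq_map]
    have := contractLeft_mem_pow ⊤ f 1 h2
    rw [pow_one, ← LinearMap.range_eq_map] at this
    exact this
  have hzero (f : Module.Dual R M) : ω * (ω * contractLeft f Q) = 0 := by
    have h := congrArg (contractLeft f) hω
    rw [contractLeft_mul_of_mem_range_ι_sq _ hωmem, map_zero] at h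
    rw [eq_neg_of_add_eq_zero_right h, mul_neg, ← mul_assoc, (hωc _).eq, mul_assoc, hω, mul_zero,
      neg_zero]
  have hA (f : Module.Dual R M) :
      contractLeft f (ι R e * ω) * (ι R e * ω) = f e • (ι R e * (ω * ω)) := by
    obtain ⟨m, hm⟩ := hαmem f
    rw [contractLeft_ι_mul, ← hm, sub_mul, ← mul_assoc (ι R e * ι R m), ι_mul_ι_mul_ι_self,
      zero_mul, sub_zero, smul_mul_assoc, ← mul_assoc, (hωc (ι R e)).eq, mul_assoc]
  have hAzero (f g : Module.Dual R M) (hg : contractLeft g Q ∈ LinearMap.range (ι R (M := M)) ^ 2) :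
      contractLeft g Q * (contractLeft f (ι R e * ω) * (ι R e * ω)) = 0 := by
    rw [hA, (commute_of_mem_range_ι_sq hg _).eq, smul_mul_assoc, mul_assoc, mul_assoc, hzero,
      mul_zero, smul_zero]
  have hAQ (f : Module.Dual R M) :
      contractLeft f (ι R e * ω) * Q = -(ι R e * (contractLeft f ω * Q)) := by
    rw [contractLeft_ι_mul, sub_mul, smul_mul_assoc, hω, smul_zero, zero_sub, mul_assoc]
  have hAAQ : contractLeft d (ι R e * ω) * (contractLeft d' (ι R e * ω) * Q) = 0 := by
    obtain ⟨m, hm⟩ := hαmem d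
    rw [hAQ, contractLeft_ι_mul, ← hm, mul_neg, sub_mul, ← mul_assoc (ι R e * ι R m),
      ι_mul_ι_mul_ι_self, zero_mul, sub_zero, smul_mul_assoc, ← mul_assoc, (hωc (ι R e)).eq,
      mul_assoc, ← mul_assoc ω, (hωc _).eq, mul_assoc, hω, mul_zero, mul_zero, smul_zero, neg_zero]
  have hQQA : contractLeft d Q * (contractLeft d' Q * (ι R e * ω))
      = ι R e * (contractLeft d Q * contractLeft d' Q * ω) := by
    rw [← mul_assoc (contractLeft d' Q), (commute_of_mem_range_ι_sq hd' (ι R e)).eq, mul_assoc,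
      ← mul_assoc, (commute_of_mem_range_ι_sq hd (ι R e)).eq, mul_assoc, mul_assoc]
  have hAQA : contractLeft d (ι R e * ω) * (contractLeft d' Q * (ι R e * ω)) = 0 := by
    rw [← mul_assoc, ← (commute_of_mem_range_ι_sq hd' _).eq, mul_assoc, hAzero d d' hd']
  have hQAQ : contractLeft d Q * (contractLeft d' (ι R e * ω) * Q)
      = contractLeft d' (ι R e * ω) * (contractLeft d Q * Q) := by
    rw [← mul_assoc, (commute_of_mem_range_ι_sq hd _).eq, mul_assoc]
  rw [mul_assoc] at hQ
  simp only [map_add, mul_assoc, mul_add, add_mul, hAAQ, hQ, hAQA, hAzero d' d hd, hQAQ] at hQQA ⊢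
  rw [hQQA]
  abel

/-- The symmetric form `(i_d φ) ∧ (i_d' φ) ∧ φ` of `φ = e ∧ ω + Re (exp (i θ) Ω)` does not depend
on the phase. -/
theorem contractLeft_mul_contractLeft_mul_rotation (e : M) {p q : R} (hpq : p ^ 2 + q ^ 2 = 1)
    {φ φ₀ : ExteriorAlgebra R M} (hφ : φ = ι R e * ω + (p • Ωp - q • Ωm))
    (hφ₀ : φ₀ = ι R e * ω + Ωp) :
    contractLeft d φ * contractLeft d' φ * φ = contractLeft d φ₀ * contractLeft d' φ₀ * φ₀ := by
  set N := Submodule.span R (Set.range ![a 0, a 1, a 2, b 0, b 1, b 2]) with hN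
  have ha (i : Fin 3) : a i ∈ N := Submodule.subset_span (by fin_cases i <;> simp)
  have hb (i : Fin 3) : b i ∈ N := Submodule.subset_span (by fin_cases i <;> simp)
  have hPN := volRe_mem (R := R) a b ha hb
  have hMN := volIm_mem (R := R) a b ha hb
  have hQN : p • Ωp - q • Ωm ∈ (N.map (ι R)) ^ 3 :=
    sub_mem (Submodule.smul_mem _ _ hPN) (Submodule.smul_mem _ _ hMN)
  have hsq (f : Module.Dual R M) {Q : ExteriorAlgebra R M} (hQ : Q ∈ (N.map (ι R)) ^ 3) :
      contractLeft f Q ∈ LinearMap.range (ι R (M := M)) ^ 2 :=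
    pow_le_pow_left' LinearMap.map_le_range 2 (contractLeft_mem_pow N f 2 hQ)
  have hdeg {Q : ExteriorAlgebra R M} (hQ : Q ∈ (N.map (ι R)) ^ 3) :
      contractLeft d Q * contractLeft d' Q * Q = 0 := by
    have h := Submodule.mul_mem_mul (Submodule.mul_mem_mul (contractLeft_mem_pow N d 2 hQ)
      (contractLeft_mem_pow N d' 2 hQ)) hQ
    rw [← pow_add, ← pow_add, hN, span_range_pow_eq_bot _ (by norm_num)] at h
    exact h
  have hωP := kahlerForm_mul_volRe (R := R) a b
  have hωM := kahlerForm_mul_volIm (R := R) a b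
  have hωQ : ω * (p • Ωp - q • Ωm) = 0 := by
    rw [mul_sub, mul_smul_comm, mul_smul_comm, hωP, hωM, smul_zero, smul_zero, sub_zero]
  have hone (w : ExteriorAlgebra R M) : (p ^ 2 + q ^ 2) • w = w := by rw [hpq, one_smul]
  have hQ (f : Module.Dual R M) :
      contractLeft f (p • Ωp - q • Ωm) * (p • Ωp - q • Ωm) = contractLeft f Ωp * Ωp := by
    simp only [map_sub, map_smul, sub_mul, mul_sub, smul_mul_assoc, mul_smul_comm,
      contractLeft_volRe_mul_volIm, ← contractLeft_volRe_mul_volRe]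
    refine Eq.trans ?_ (hone (contractLeft f Ωp * Ωp))
    module
  have hPP := contractLeft_mul_contractLeft_mul_kahlerForm a b d d' (hsq d hPN) (hsq d hMN)
    (contractLeft_volRe_mul_volRe a b d) hωP hωM
  have hPM := contractLeft_mul_contractLeft_mul_kahlerForm a b d d' (P' := Ωm) (Q' := -Ωp)
    (hsq d hPN) (hsq d hMN) (by rw [contractLeft_volRe_mul_volIm, mul_neg]) hωM
    (by rw [mul_neg, hωP, neg_zero])
  have hQQ : contractLeft d (p • Ωp - q • Ωm) * contractLeft d' (p • Ωp - q • Ωm) * ω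
      = contractLeft d Ωp * contractLeft d' Ωp * ω := by
    simp only [map_neg, mul_neg, neg_mul] at hPM
    simp only [map_sub, map_smul, sub_mul, mul_sub, smul_mul_assoc, mul_smul_comm, hPM, ← hPP]
    refine Eq.trans ?_ (hone (contractLeft d Ωp * contractLeft d' Ωp * ω))
    module
  rw [hφ, hφ₀, contractLeft_mul_contractLeft_mul_add d d' e (hsq d hQN) (hsq d' hQN) hωQ (hdeg hQN),
    contractLeft_mul_contractLeft_mul_add d d' e (hsq d hPN) (hsq d' hPN) hωP (hdeg hPN),
    hQ, hQ, hQQ]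

end PhaseInvariance

end ExteriorAlgebra

open ExteriorAlgebra in
/-- The `G₂`-form `√c₇ v⁷ ∧ ω + cos θ Ω₊ - sin θ Ω₋` in rescaled coordinates, in which `ω` and
`Ω₊ + i Ω₋` are standard. -/
theorem phi_eq_rescaled {s ℓ : ℝ} (hs : 0 < s) (hℓ : 0 < ℓ) (k p q : ℝ) :
    k • (v7 6 * Real.sqrt (s * ℓ) • (v7 0 * v7 3 + v7 1 * v7 4 - v7 2 * v7 5))
      + (p • (Real.sqrt (s ^ 3) • (v7 0 * v7 1 * v7 2)
          + (ℓ * Real.sqrt s) • (v7 0 * v7 4 * v7 5 - v7 1 * v7 3 * v7 5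
              - v7 2 * v7 3 * v7 4))
        - q • (Real.sqrt (ℓ ^ 3) • (v7 3 * v7 4 * v7 5)
          + (s * Real.sqrt ℓ) • (v7 1 * v7 2 * v7 3 - v7 0 * v7 2 * v7 4
              - v7 0 * v7 1 * v7 5)))
    = ι ℝ (k • (Pi.single 6 1 : Fin 7 → ℝ))
        * kahlerForm (fun i : Fin 3 => Real.sqrt s • (Pi.single (![0, 1, 2] i) 1 : Fin 7 → ℝ))
          (fun i : Fin 3 => Real.sqrt ℓ • (Pi.single (![3, 4, 5] i) 1 : Fin 7 → ℝ))
      + (p • volRe (fun i : Fin 3 => Real.sqrt s • (Pi.single (![0, 1, 2] i) 1 : Fin 7 → ℝ))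
          (fun i : Fin 3 => Real.sqrt ℓ • (Pi.single (![3, 4, 5] i) 1 : Fin 7 → ℝ))
        - q • volIm (fun i : Fin 3 => Real.sqrt s • (Pi.single (![0, 1, 2] i) 1 : Fin 7 → ℝ))
          (fun i : Fin 3 => Real.sqrt ℓ • (Pi.single (![3, 4, 5] i) 1 : Fin 7 → ℝ))) := by
  obtain ⟨x, hx, rfl⟩ : ∃ x : ℝ, 0 < x ∧ s = x ^ 2 :=
    ⟨Real.sqrt s, Real.sqrt_pos.2 hs, (Real.sq_sqrt hs.le).symm⟩
  obtain ⟨y, hy, rfl⟩ : ∃ y : ℝ, 0 < y ∧ ℓ = y ^ 2 :=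
    ⟨Real.sqrt ℓ, Real.sqrt_pos.2 hℓ, (Real.sq_sqrt hℓ.le).symm⟩
  have hcube {z : ℝ} (hz : 0 < z) : Real.sqrt ((z ^ 2) ^ 3) = z ^ 3 := by
    rw [← pow_mul, mul_comm, pow_mul, Real.sqrt_sq (by positivity)]
  have hxy : Real.sqrt (x ^ 2 * y ^ 2) = x * y := by
    rw [← mul_pow, Real.sqrt_sq (by positivity)]
  rw [hcube hx, hcube hy, hxy, Real.sqrt_sq hx.le, Real.sqrt_sq hy.le]
  simp only [v7, kahlerForm, volRe, volIm, map_smul, smul_mul_assoc, mul_smul_comm,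
    Matrix.cons_val_zero, Matrix.cons_val_one, Matrix.cons_val, mul_add, mul_sub]
  module

/-- with `ω`, `Ω₊`, `Ω₋` as in the statement (dual basis indexed here by
`0, …, 6`) and `φ^θ = √c₇ v⁷∧ω + cos θ · Ω₊ − sin θ · Ω₋`, for `φ³ = φ^0`, `φ⁴ = φ^{θ₁}`,
`φ⁵ = φ^{θ₂}` with `tan θ₁ = √(ℓ/s)` and `tan θ₂ = −√(s/ℓ)`, there are signs
`ε₄, ε₅ ∈ {±1}` such that `(i_x φ⁴)∧(i_y φ⁴)∧φ⁴ = ε₄ (i_x φ³)∧(i_y φ³)∧φ³` and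
`(i_x φ⁵)∧(i_y φ⁵)∧φ⁵ = ε₅ (i_x φ³)∧(i_y φ³)∧φ³` for all `x, y ∈ ℝ⁷`; in particular
`φ³, φ⁴, φ⁵` determine the same metric on `ℝ⁷`. -/
theorem statement15 (s ℓ c₇ : ℝ) (hs : 0 < s) (hℓ : 0 < ℓ) (hc₇ : 0 < c₇)
    (θ₁ θ₂ : ℝ) (hθ₁ : Real.tan θ₁ = Real.sqrt (ℓ / s))
    (hθ₂ : Real.tan θ₂ = -Real.sqrt (s / ℓ)) :
    ∀ ω Ωp Ωm : ExteriorAlgebra ℝ (Fin 7 → ℝ),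
      ω = Real.sqrt (s * ℓ) • (v7 0 * v7 3 + v7 1 * v7 4 - v7 2 * v7 5) →
      Ωp = Real.sqrt (s ^ 3) • (v7 0 * v7 1 * v7 2)
          + (ℓ * Real.sqrt s) • (v7 0 * v7 4 * v7 5 - v7 1 * v7 3 * v7 5
              - v7 2 * v7 3 * v7 4) →
      Ωm = Real.sqrt (ℓ ^ 3) • (v7 3 * v7 4 * v7 5)
          + (s * Real.sqrt ℓ) • (v7 1 * v7 2 * v7 3 - v7 0 * v7 2 * v7 4
              - v7 0 * v7 1 * v7 5) →
      ∀ φ : ℝ → ExteriorAlgebra ℝ (Fin 7 → ℝ),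
        (φ = fun θ => Real.sqrt c₇ • (v7 6 * ω)
          + (Real.cos θ • Ωp - Real.sin θ • Ωm)) →
        ∃ ε₄ ε₅ : ℝ, (ε₄ = 1 ∨ ε₄ = -1) ∧ (ε₅ = 1 ∨ ε₅ = -1) ∧
          (∀ x y : Fin 7 → ℝ,
            interiorProd x (φ θ₁) * interiorProd y (φ θ₁) * φ θ₁
              = ε₄ • (interiorProd x (φ 0) * interiorProd y (φ 0) * φ 0)) ∧
          (∀ x y : Fin 7 → ℝ,
            interiorProd x (φ θ₂) * interiorProd y (φ θ₂) * φ θ₂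
              = ε₅ • (interiorProd x (φ 0) * interiorProd y (φ 0) * φ 0)) := by
  rintro ω Ωp Ωm rfl rfl rfl φ rfl
  have key (θ : ℝ) (x y : Fin 7 → ℝ) := ExteriorAlgebra.contractLeft_mul_contractLeft_mul_rotation
    (∑ i, x i • (LinearMap.proj i : (Fin 7 → ℝ) →ₗ[ℝ] ℝ))
    (∑ i, y i • (LinearMap.proj i : (Fin 7 → ℝ) →ₗ[ℝ] ℝ)) _ (Real.cos_sq_add_sin_sq θ)
    (phi_eq_rescaled hs hℓ (Real.sqrt c₇) (Real.cos θ) (Real.sin θ))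
    ((phi_eq_rescaled hs hℓ (Real.sqrt c₇) (Real.cos 0) (Real.sin 0)).trans (by simp))
  refine ⟨1, 1, Or.inl rfl, Or.inl rfl, fun x y => ?_, fun x y => ?_⟩
  · rw [one_smul]
    exact key θ₁ x y
  · rw [one_smul]
    exact key θ₂ x y
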